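/- arXiv:1308.1499 — 4 statements merged into one kernel-verified Lean document; each statement's English description precedes it below -/
import Mathlib

section
/- Let G be a discrete group and A an infinite subset of G. Then A is small if and only if for every free ultrafilter p ∈ G* and every finite subset F of G one has ϑ_p(FA) ≠ Gp. -/
open Pointwise

/-- The extension of the group multiplication to `βG`, the space of ultrafilters on `G`:
`A ∈ uMul p q ↔ {g : g⁻¹A ∈ q} ∈ p`. -/
def uMul {G : Type*} [Group G] (p q : Ultrafilter G) : Ultrafilter G :=
  p.bind fun g => q.map (g * ·)

/-- An ultrafilter is free if it is not principal. -/
def uFree {G : Type*} (p : Ultrafilter G) : Prop := ∀ g : G, p ≠ pure g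

/-- `A* = Ā ∩ G*`, the set of free ultrafilters containing `A`. -/
def uStar {G : Type*} (A : Set G) : Set (Ultrafilter G) := {p | A ∈ p ∧ uFree p}

/-- `Gp = {gp : g ∈ G}`. -/
def uOrbit {G : Type*} [Group G] (p : Ultrafilter G) : Set (Ultrafilter G) :=
  {q | ∃ g : G, q = uMul (pure g) p}

/-- The `p`-companion of `A`: `ϑ_p(A) = A* ∩ Gp`. -/
def uCompanion {G : Type*} [Group G] (A : Set G) (p : Ultrafilter G) : Set (Ultrafilter G) :=
  uStar A ∩ uOrbit p

/-- A set is sparse if all its ultracompanions are finite. -/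
def uSparse {G : Type*} [Group G] (A : Set G) : Prop :=
  ∀ p : Ultrafilter G, uFree p → (uCompanion A p).Finite

/-- A set is disparse if all its ultracompanions are discrete subspaces of `βG`. -/
def uDisparse {G : Type*} [Group G] (A : Set G) : Prop :=
  ∀ p : Ultrafilter G, uFree p → DiscreteTopology (uCompanion A p)

/-- `A` is large if `G = FA` for some finite `F`. -/
def uLarge {G : Type*} [Group G] (A : Set G) : Prop :=
  ∃ F : Set G, F.Finite ∧ (Set.univ : Set G) = F * A

/-- `A` is thick if every finite set has a right translate inside `A` with translating
element from `A`. -/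
def uThick {G : Type*} [Group G] (A : Set G) : Prop :=
  ∀ F : Set G, F.Finite → ∃ a ∈ A, (· * a) '' F ⊆ A

/-- `A` is prethick if `FA` is thick for some finite `F`. -/
def uPrethick {G : Type*} [Group G] (A : Set G) : Prop :=
  ∃ F : Set G, F.Finite ∧ uThick (F * A)

/-- `A` is small if `L \ A` is large for every large `L`. -/
def uSmall {G : Type*} [Group G] (A : Set G) : Prop :=
  ∀ L : Set G, uLarge L → uLarge (L \ A)

/-- `A` is thin if `gA ∩ A` is finite for all `g ≠ e`. -/
def uThin {G : Type*} [Group G] (A : Set G) : Prop :=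
  ∀ g : G, g ≠ 1 → (g • A ∩ A).Finite

/-- `FP(a_n) = {a_{i₁} ⋯ a_{i_n} : i₁ < ⋯ < i_n}`. -/
def uFP {G : Type*} [Group G] (a : ℕ → G) : Set G :=
  {g | ∃ l : List ℕ, l ≠ [] ∧ l.Pairwise (· < ·) ∧ g = (l.map a).prod}

lemma mem_uMul_pure {G : Type*} [Group G] (g : G) (p : Ultrafilter G) (B : Set G) :
    B ∈ uMul (pure g) p ↔ (fun x => g * x) ⁻¹' B ∈ p := Iff.rfl

lemma uFree_uMul {G : Type*} [Group G] (g : G) (p : Ultrafilter G) (hp : uFree p) :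
    uFree (uMul (pure g) p) := by
  intro x hx
  apply hp (g⁻¹ * x)
  have h : ({x} : Set G) ∈ uMul (pure g) p := by
    rw [hx]; exact Set.mem_singleton x
  rw [mem_uMul_pure] at h
  have h2 : ({g⁻¹ * x} : Set G) ∈ p := by
    refine Filter.mem_of_superset h ?_
    intro y hy
    have hy' : g * y = x := hy
    simp [← hy']
  have h3 : (p : Filter G) ≤ pure (g⁻¹ * x) := by
    rw [Filter.le_pure_iff]; exact h2
  exact (Ultrafilter.coe_le_coe (f := p) (g := pure (g⁻¹ * x))).1 h3

lemma uCompanion_eq_iff {G : Type*} [Group G] (B : Set G) (p : Ultrafilter G) (hp : uFree p) :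
    uCompanion B p = uOrbit p ↔ ∀ g : G, (fun x => g * x) ⁻¹' B ∈ p := by
  constructor
  · intro h g
    have : uMul (pure g) p ∈ uCompanion B p := by rw [h]; exact ⟨g, rfl⟩
    exact this.1.1
  · intro h
    apply Set.Subset.antisymm
    · exact Set.inter_subset_right
    · rintro q ⟨g, rfl⟩
      exact ⟨⟨h g, uFree_uMul g p hp⟩, g, rfl⟩

lemma uLarge_smul {G : Type*} [Group G] (f : G) (L : Set G) (h : uLarge L) :
    uLarge (f • L) := by
  obtain ⟨F, hF, hL⟩ := h
  refine ⟨(fun x => x * f⁻¹) '' F, hF.image _, ?_⟩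
  symm
  rw [Set.eq_univ_iff_forall]
  intro x
  have hx : x ∈ F * L := by rw [← hL]; trivial
  obtain ⟨a, ha, b, hb, rfl⟩ := hx
  exact ⟨a * f⁻¹, ⟨a, ha, rfl⟩, f * b, ⟨b, hb, rfl⟩, by simp⟩

lemma uLarge_diff_mul {G : Type*} [Group G] (A : Set G) (hA : uSmall A) (F : Set G)
    (hF : F.Finite) : ∀ L : Set G, uLarge L → uLarge (L \ (F * A)) := by
  induction F, hF using Set.Finite.induction_on with
  | empty => intro L hL; simpa using hL
  | @insert a s _ _ ih =>
    intro L hL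
    have h1 := uLarge_smul a _ (hA _ (uLarge_smul a⁻¹ _ (ih L hL)))
    convert h1 using 1
    rw [Set.smul_set_sdiff, smul_inv_smul, Set.insert_eq, Set.union_mul, Set.singleton_mul,
      Set.union_comm, ← Set.sdiff_sdiff]
    rfl

/-- Proposition 3(iii): `A` is small iff `ϑ_p(FA) ≠ Gp` for all `p ∈ G*` and finite `F`. -/
theorem statement6 {G : Type*} [Group G] (A : Set G) (hA : A.Infinite) :
    uSmall A ↔ ∀ p : Ultrafilter G, uFree p →
      ∀ F : Set G, F.Finite → uCompanion (F * A) p ≠ uOrbit p := by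
  constructor
  · intro h p hp F hF he
    rw [uCompanion_eq_iff _ _ hp] at he
    obtain ⟨K, hK, hu⟩ := uLarge_diff_mul A h F hF Set.univ ⟨{1}, Set.finite_singleton 1, by simp⟩
    have hint : (⋂ k ∈ K, (fun x => k⁻¹ * x) ⁻¹' (F * A)) ∈ p :=
      (Filter.biInter_mem hK).2 fun k _ => he k⁻¹
    obtain ⟨x, hx⟩ := p.nonempty_of_mem hint
    have hxu : x ∈ K * (Set.univ \ (F * A)) := by rw [← hu]; trivial
    obtain ⟨k, hk, y, hy, rfl⟩ := hxu
    have := Set.mem_iInter₂.1 hx k hk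
    simp only [Set.mem_preimage, inv_mul_cancel_left] at this
    exact hy.2 this
  · intro h L hL
    obtain ⟨H, hH, hHL⟩ := hL
    have key : uLarge ((H * A)ᶜ) := by
      by_contra hn
      have hfin : ∀ K : Set G, K.Finite → ∃ x, ∀ k ∈ K, k * x ∈ H * A := by
        intro K hK
        by_contra! hc
        refine hn ⟨K⁻¹, hK.inv, (Set.eq_univ_iff_forall.2 fun x => ?_).symm⟩
        obtain ⟨k, hk, hx⟩ := hc x
        exact ⟨k⁻¹, by simpa using hk, k * x, hx, by simp⟩
      have hinf : Infinite G := Set.infinite_univ_iff.1 (hA.mono (Set.subset_univ A))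
      by_cases hB : H * A = Set.univ
      · have hp : uFree (Filter.hyperfilter G) := by
          intro g hg
          have h1 : ({g} : Set G) ∈ Filter.hyperfilter G := by
            rw [hg]; exact Set.mem_singleton g
          exact Set.Finite.notMem_hyperfilter (Set.finite_singleton g) h1
        refine h _ hp H hH ((uCompanion_eq_iff _ _ hp).2 fun g => ?_)
        rw [hB]; exact Filter.univ_mem
      · let S : Set (Set G) := Set.range fun g : G => (fun x => g * x) ⁻¹' (H * A)
        have hne : (Filter.generate S).NeBot := by
          rw [Filter.generate_neBot_iff]
          intro t ht htf
          obtain ⟨K, hKf, rfl⟩ : ∃ K : Set G, K.Finite ∧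
              (fun g : G => (fun x => g * x) ⁻¹' (H * A)) '' K = t := by
            choose! f hf using ht
            refine ⟨f '' t, htf.image f, ?_⟩
            rw [Set.image_image]
            exact (Set.image_congr fun a ha => hf ha).trans (Set.image_id' t)
          obtain ⟨x, hx⟩ := hfin K hKf
          refine ⟨x, ?_⟩
          rintro _ ⟨k, hk, rfl⟩
          exact hx k hk
        have hp0 := Ultrafilter.of_le (Filter.generate S)
        have hp1 : ∀ g : G, (fun x => g * x) ⁻¹' (H * A) ∈ Ultrafilter.of (Filter.generate S) :=
          fun g => hp0 (Filter.GenerateSets.basic ⟨g, rfl⟩)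
        have hp : uFree (Ultrafilter.of (Filter.generate S)) := by
          intro x hx
          apply hB
          rw [Set.eq_univ_iff_forall]
          intro y
          have h1 := hp1 (y * x⁻¹)
          rw [hx] at h1
          have h2 : y * x⁻¹ * x ∈ H * A := h1
          simpa using h2
        exact h _ hp H hH ((uCompanion_eq_iff _ _ hp).2 hp1)
    obtain ⟨K, hK, hu⟩ := key
    refine ⟨K * H, hK.mul hH, (Set.eq_univ_iff_forall.2 fun x => ?_).symm⟩
    have hx : x ∈ K * (H * A)ᶜ := by rw [← hu]; trivial
    obtain ⟨k, hk, y, hy, rfl⟩ := hx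
    have hy2 : y ∈ H * L := by rw [← hHL]; trivial
    obtain ⟨a, ha, l, hl, rfl⟩ := hy2
    exact ⟨k * a, ⟨k, hk, a, ha, rfl⟩, l, ⟨hl, fun hlA => hy ⟨a, ha, l, hlA, rfl⟩⟩,
      by simp [mul_assoc]⟩
end

section
/- Let G be a discrete group and A a subset of G. Then A is sparse if and only if for every infinite subset X of G there exists a finite subset F ⊆ X such that ⋂_{g ∈ F} gA is finite. -/
open Pointwise

theorem aux_mem_uMul {G : Type*} [Group G] (g : G) (p : Ultrafilter G) (S : Set G) :
    S ∈ uMul (pure g) p ↔ g⁻¹ • S ∈ p := by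
  have h : S ∈ uMul (pure g) p ↔ (g * ·) ⁻¹' S ∈ p := Iff.rfl
  rw [h]
  have : (g * ·) ⁻¹' S = g⁻¹ • S := by
    ext x
    simp [Set.mem_smul_set_iff_inv_smul_mem]
  rw [this]

theorem aux_not_finite {G : Type*} {p : Ultrafilter G} (hp : uFree p) {S : Set G}
    (hS : S.Finite) : S ∉ p := by
  intro h
  obtain ⟨x, -, hx⟩ := Ultrafilter.eq_pure_of_finite_mem hS h
  exact hp x hx

theorem aux_exists {G : Type*} [Group G] (g : G) (hg : g ≠ 1) :
    ∃ B : Set G, Disjoint B (g • B) ∧ B ∪ g • B ∪ g⁻¹ • B = Set.univ := by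
  obtain ⟨B, hB⟩ := zorn_subset {B : Set G | ∀ x ∈ B, g * x ∉ B} (by
    intro c hc hchain
    refine ⟨⋃₀ c, ?_, fun s hs => Set.subset_sUnion_of_mem hs⟩
    rintro x ⟨s, hs, hxs⟩ ⟨t, ht, hxt⟩
    rcases hchain.total hs ht with h | h
    · exact hc ht x (h hxs) hxt
    · exact hc hs x hxs (h hxt))
  have hP : ∀ x ∈ B, g * x ∉ B := hB.prop
  refine ⟨B, ?_, ?_⟩
  · rw [Set.disjoint_left]
    rintro _ hx ⟨y, hy, rfl⟩
    exact hP y hy hx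
  · rw [Set.eq_univ_iff_forall]
    intro x
    by_contra hx
    simp only [Set.mem_union, Set.mem_smul_set_iff_inv_smul_mem, smul_eq_mul, inv_inv,
      not_or] at hx
    obtain ⟨⟨h1, h2⟩, h3⟩ := hx
    have hins : ∀ y ∈ insert x B, g * y ∉ insert x B := by
      rintro y (rfl | hy) (h | h)
      · exact hg (by simpa using h)
      · exact h3 h
      · apply h2
        rw [← h]
        simpa using hy
      · exact hP y hy h
    exact h1 (hB.le_of_ge (y := insert x B) hins (Set.subset_insert x B)
      (Set.mem_insert x B))

theorem aux_free {G : Type*} [Group G] (p : Ultrafilter G) {a b : G}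
    (h : uMul (pure a) p = uMul (pure b) p) : a = b := by
  by_contra hab
  have key : ∀ S : Set G, S ∈ p ↔ (b⁻¹ * a) • S ∈ p := by
    intro S
    have : a • S ∈ uMul (pure a) p ↔ a • S ∈ uMul (pure b) p := by rw [h]
    rw [aux_mem_uMul, aux_mem_uMul, smul_smul, smul_smul] at this
    simpa using this
  have hg : b⁻¹ * a ≠ 1 := by
    intro h1
    exact hab (inv_mul_eq_one.1 h1).symm
  obtain ⟨B, hd, hu⟩ := aux_exists _ hg
  have hBp : B ∈ p := by
    have : B ∪ (b⁻¹ * a) • B ∪ (b⁻¹ * a)⁻¹ • B ∈ p := by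
      rw [hu]; exact Filter.univ_mem
    rw [Ultrafilter.union_mem_iff, Ultrafilter.union_mem_iff] at this
    rcases this with (h1 | h1) | h1
    · exact h1
    · exact (key B).2 h1
    · simpa only [smul_inv_smul] using (key _).1 h1
  have := Filter.inter_mem hBp ((key B).1 hBp)
  rw [hd.inter_eq] at this
  exact p.empty_notMem this

theorem aux_uFree {G : Type*} [Group G] {p : Ultrafilter G} (hp : uFree p) (g : G) :
    uFree (uMul (pure g) p) := by
  intro x hx
  have h : {x} ∈ uMul (pure g) p := by rw [hx]; exact Set.mem_singleton x
  rw [aux_mem_uMul] at h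
  exact aux_not_finite hp ((Set.finite_singleton x).smul_set) h

/-- Proposition 5, (i) ⇔ (iii): `A` is sparse iff every infinite `X ⊆ G` has a finite
subset `F` with `⋂_{g ∈ F} gA` finite. -/
theorem statement10 {G : Type*} [Group G] (A : Set G) :
    uSparse A ↔ ∀ X : Set G, X.Infinite →
      ∃ F : Set G, F ⊆ X ∧ F.Finite ∧ (⋂ g ∈ F, g • A).Finite := by
  constructor
  · intro hA X hX
    by_contra hcon
    push Not at hcon
    let f : Filter G := (⨅ g ∈ X, Filter.principal (g • A)) ⊓ Filter.cofinite
    have hne : f.NeBot := by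
      rw [Filter.inf_neBot_iff]
      intro s hs t ht
      rw [Filter.mem_biInf_principal] at hs
      obtain ⟨F, hF, hFX, hs⟩ := hs
      have hinf := hcon F hFX hF
      by_contra hemp
      rw [Set.not_nonempty_iff_eq_empty] at hemp
      refine hinf (Set.Finite.subset (Filter.mem_cofinite.1 ht) ?_)
      intro x hx hxt
      have : x ∈ s ∩ t := ⟨hs hx, hxt⟩
      rw [hemp] at this
      exact this
    let p : Ultrafilter G := Ultrafilter.of f
    have hpf : (p : Filter G) ≤ f := Ultrafilter.of_le f
    have hp : uFree p := by
      intro x hx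
      have h1 : ({x}ᶜ : Set G) ∈ p :=
        hpf (Filter.mem_inf_of_right (Set.finite_singleton x).compl_mem_cofinite)
      rw [hx] at h1
      exact (h1 : x ∈ ({x}ᶜ : Set G)) rfl
    have hpA : ∀ g ∈ X, g • A ∈ p := fun g hg =>
      hpf (Filter.mem_inf_of_left (Filter.mem_iInf_of_mem g
        (Filter.mem_iInf_of_mem hg (Filter.mem_principal_self _))))
    have hinj : Set.InjOn (fun g : G => uMul (pure g⁻¹) p) X := by
      intro a _ b _ hab
      exact inv_injective (aux_free p hab)
    refine (hX.image hinj) ((hA p hp).subset ?_)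
    rintro _ ⟨g, hg, rfl⟩
    refine ⟨⟨?_, aux_uFree hp _⟩, g⁻¹, rfl⟩
    rw [aux_mem_uMul, inv_inv]
    exact hpA g hg
  · intro h p hp
    by_contra hinf
    have hX : {g : G | g • A ∈ p}.Infinite := by
      intro hfin
      refine hinf ((hfin.image (fun g : G => uMul (pure g⁻¹) p)).subset ?_)
      rintro _ ⟨⟨h1, -⟩, g, rfl⟩
      rw [aux_mem_uMul] at h1
      exact ⟨g⁻¹, h1, by simp⟩
    obtain ⟨F, hFX, hF, hfin⟩ := h _ hX
    exact aux_not_finite hp hfin ((Filter.biInter_mem hF).2 fun g hg => hFX hg)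
end

section
/- Let G be a discrete group. The family dSp_G of all disparse subsets of G is a left and right translation invariant ideal in the Boolean algebra of all subsets of G: if A and B are disparse then A ∪ B is disparse; any subset of a disparse set is disparse; and for every disparse A and g ∈ G, both gA and Ag are disparse. -/
open Pointwise

theorem aux_mul_pure {G : Type*} [Group G] (g : G) (p : Ultrafilter G) :
    uMul (pure g) p = p.map (g * ·) := by
  apply Ultrafilter.coe_injective
  ext s
  rfl

theorem aux_map_map {G : Type*} [Group G] (g h : G) (p : Ultrafilter G) :
    (p.map (h * ·)).map (g * ·) = p.map (g * h * ·) := by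
  rw [Ultrafilter.map_map]
  congr 1
  ext x
  simp [mul_assoc]

theorem aux_free_s15 {G : Type*} (e : Equiv.Perm G) (p : Ultrafilter G) (hp : uFree p) :
    uFree (p.map e) := by
  intro g hg
  apply hp (e.symm g)
  have := congrArg (Ultrafilter.map e.symm) hg
  rw [Ultrafilter.map_map, Ultrafilter.map_pure] at this
  simpa using this

theorem aux_free_mul {G : Type*} [Group G] (g : G) (p : Ultrafilter G) (hp : uFree p) :
    uFree (p.map (g * ·)) := aux_free_s15 (Equiv.mulLeft g) p hp

/-- Pointwise characterization of disparse sets. -/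
theorem aux_iff {G : Type*} [Group G] (A : Set G) : uDisparse A ↔
    ∀ p : Ultrafilter G, uFree p → A ∈ p → ∃ S ∈ p, ∀ k : G,
      A ∈ p.map (k * ·) → S ∈ p.map (k * ·) → p.map (k * ·) = p := by
  unfold uDisparse
  simp only [discreteTopology_subtype_iff']
  constructor
  · intro H p hp hA
    have h1 : uMul (pure 1) p = p := by
      rw [aux_mul_pure]; simp
    obtain ⟨U, hU, hUp⟩ := H p hp p ⟨⟨hA, hp⟩, 1, h1.symm⟩
    have hpU : p ∈ U := by
      have : p ∈ U ∩ uCompanion A p := by rw [hUp]; rfl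
      exact this.1
    obtain ⟨T, ⟨S, rfl⟩, hpS, hSU⟩ :=
      ultrafilterBasis_is_basis.exists_subset_of_mem_open hpU hU
    refine ⟨S, hpS, fun k hk hS => ?_⟩
    have : p.map (k * ·) ∈ U ∩ uCompanion A p :=
      ⟨hSU hS, ⟨hk, aux_free_mul k p hp⟩, k, (aux_mul_pure k p).symm⟩
    rw [hUp] at this
    exact this
  · rintro H p hp q ⟨⟨hA, hq⟩, h, hh⟩
    rw [aux_mul_pure] at hh
    obtain ⟨S, hS, H'⟩ := H q hq hA
    refine ⟨{u | S ∈ u}, ultrafilter_isOpen_basic S, ?_⟩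
    ext r
    constructor
    · rintro ⟨hr, ⟨hAr, -⟩, k, hk⟩
      rw [aux_mul_pure] at hk
      have e : q.map (k * h⁻¹ * ·) = r := by
        rw [hh, aux_map_map, hk]; simp
      have := H' (k * h⁻¹)
      rw [e] at this
      exact this hAr hr
    · rintro rfl
      exact ⟨hS, ⟨hA, hq⟩, h, by rw [aux_mul_pure, hh]⟩

/-- Proposition 10: the disparse subsets form a left and right translation invariant ideal. -/
theorem statement15 {G : Type*} [Group G] :
    (∀ A B : Set G, uDisparse A → uDisparse B → uDisparse (A ∪ B))
    ∧ (∀ A A' : Set G, uDisparse A → A' ⊆ A → uDisparse A')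
    ∧ (∀ A : Set G, uDisparse A → ∀ g : G, uDisparse (g • A) ∧ uDisparse ((· * g) '' A)) := by
  simp only [aux_iff]
  have mono : ∀ A A' : Set G, (∀ p : Ultrafilter G, uFree p → A ∈ p → ∃ S ∈ p, ∀ k : G,
      A ∈ p.map (k * ·) → S ∈ p.map (k * ·) → p.map (k * ·) = p) → ∀ p : Ultrafilter G,
      uFree p → A ∈ p → ∃ S ∈ p, ∀ k : G,
      A' ∈ p.map (k * ·) → S ∈ p.map (k * ·) → p.map (k * ·) = p := by
    intro A A' H p hp hA
    obtain ⟨S, hS, h⟩ := H p hp hA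
    exact ⟨S ∩ A, Filter.inter_mem hS hA, fun k _ hk =>
      h k (Filter.mem_of_superset hk Set.inter_subset_right)
        (Filter.mem_of_superset hk Set.inter_subset_left)⟩
  refine ⟨?_, ?_, ?_⟩
  · intro A B hA hB p hp hAB
    rcases Ultrafilter.union_mem_iff.1 hAB with h | h
    · exact mono A _ hA p hp h
    · exact mono B _ hB p hp h
  · intro A A' hA hs p hp h
    exact mono A _ hA p hp (Filter.mem_of_superset h hs)
  · intro A H g
    constructor
    · intro p hp hA
      have e1 : ∀ S : Set G, g • S = (g⁻¹ * ·) ⁻¹' S := by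
        intro S; ext x; simp [Set.mem_smul_set_iff_inv_smul_mem]
      have e : (p.map (g⁻¹ * ·)).map (g * ·) = p := by rw [aux_map_map]; simp
      rw [e1] at hA ⊢
      obtain ⟨S, hS, h⟩ := H (p.map (g⁻¹ * ·)) (aux_free_mul _ p hp) hA
      refine ⟨(g⁻¹ * ·) ⁻¹' S, hS, fun k hk hk' => ?_⟩
      have e2 : (p.map (g⁻¹ * ·)).map (g⁻¹ * k * g * ·) = (p.map (k * ·)).map (g⁻¹ * ·) := by
        rw [aux_map_map, aux_map_map]; simp [mul_assoc]
      have h3 := h (g⁻¹ * k * g)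
      rw [e2] at h3
      have h4 := congrArg (Ultrafilter.map (g * ·)) (h3 hk hk')
      rw [e, aux_map_map] at h4
      rw [aux_map_map] at h4
      simpa using h4
    · intro p hp hA
      have e1 : (· * g) '' A = (· * g⁻¹) ⁻¹' A := by
        ext x; simp
      have e : ∀ q : Ultrafilter G, (q.map (· * g⁻¹)).map (· * g) = q := by
        intro q
        rw [Ultrafilter.map_map]
        convert Ultrafilter.map_id q using 2
        ext x; simp
      rw [e1] at hA ⊢
      obtain ⟨S, hS, h⟩ := H (p.map (· * g⁻¹)) (aux_free_s15 (Equiv.mulRight g⁻¹) p hp) hA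
      refine ⟨(· * g⁻¹) ⁻¹' S, hS, fun k hk hk' => ?_⟩
      have e2 : (p.map (· * g⁻¹)).map (k * ·) = (p.map (k * ·)).map (· * g⁻¹) := by
        rw [Ultrafilter.map_map, Ultrafilter.map_map]
        congr 1
        ext x; simp [mul_assoc]
      have h3 := h k
      rw [e2] at h3
      have h4 := congrArg (Ultrafilter.map (· * g)) (h3 hk hk')
      rw [e, e] at h4
      exact h4
end

section
/- Let G be a discrete group and A a disparse subset of G. Then: (i) if q is an idempotent ultrafilter in G* and g ∈ G, then qg ∉ A*; equivalently, (ii) for each injective sequence (a_n)_{n<ω} in G and each g ∈ G, the set FP(a_n)_{n<ω}·g \ A is infinite. -/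
open Pointwise

theorem aux_mem_uMul_s16 {G : Type*} [Group G] (p q : Ultrafilter G) (s : Set G) :
    s ∈ uMul p q ↔ ∀ᶠ x in p, ∀ᶠ y in q, x * y ∈ s := Iff.rfl

theorem aux_mem_pure_mul {G : Type*} [Group G] (h : G) (q : Ultrafilter G) (s : Set G) :
    s ∈ uMul (pure h) q ↔ ∀ᶠ y in q, h * y ∈ s := by
  rw [aux_mem_uMul_s16]
  exact Filter.eventually_pure

theorem aux_mem_mul_pure {G : Type*} [Group G] (g : G) (q : Ultrafilter G) (s : Set G) :
    s ∈ uMul q (pure g) ↔ ∀ᶠ y in q, y * g ∈ s := by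
  rw [aux_mem_uMul_s16]
  exact Iff.rfl

theorem aux_free_iff {G : Type*} (p : Ultrafilter G) :
    uFree p ↔ ∀ g : G, ({g}ᶜ : Set G) ∈ p := by
  unfold uFree
  refine forall_congr' fun g => ?_
  rw [Ultrafilter.compl_mem_iff_notMem, not_iff_not]
  constructor
  · rintro rfl
    exact Filter.mem_pure.2 rfl
  · intro h
    apply Ultrafilter.coe_le_coe.1
    rw [Ultrafilter.coe_pure]
    exact Filter.le_pure_iff.2 h

theorem aux_free_mul_s16 {G : Type*} [Group G] (p q : Ultrafilter G) (hq : uFree q) :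
    uFree (uMul p q) := by
  rw [aux_free_iff] at *
  intro g
  rw [aux_mem_uMul_s16]
  refine Filter.Eventually.of_forall fun x => ?_
  filter_upwards [hq (x⁻¹ * g)] with y hy hxy
  apply hy
  rw [Set.mem_singleton_iff] at *
  rw [← hxy]; group

theorem aux_free_mul_pure {G : Type*} [Group G] (q : Ultrafilter G) (hq : uFree q) (g : G) :
    uFree (uMul q (pure g)) := by
  rw [aux_free_iff] at *
  intro k
  rw [aux_mem_mul_pure]
  filter_upwards [hq (k * g⁻¹)] with y hy hxy
  apply hy
  rw [Set.mem_singleton_iff] at *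
  rw [← hxy]; group

/-- Left translation by a nontrivial element has no fixed ultrafilters. -/
theorem aux_no_fixed {G : Type*} [Group G] (h : G) (hh : h ≠ 1) (p : Ultrafilter G)
    (hp : uMul (pure h) p = p) : False := by
  have key : ∀ s : Set G, s ∈ p ↔ {y | h * y ∈ s} ∈ p := fun s => by
    conv_lhs => rw [← hp]
    exact aux_mem_pure_mul h p s
  obtain ⟨T, hT⟩ : ∃ T, Maximal (· ∈ {T : Set G | ∀ x ∈ T, h * x ∉ T}) T := by
    refine zorn_subset _ fun c hc hchain => ⟨⋃₀ c, ?_, fun s hs => Set.subset_sUnion_of_mem hs⟩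
    rintro x ⟨s, hs, hxs⟩ ⟨t, ht, hxt⟩
    rcases hchain.total hs ht with hst | hst
    · exact hc ht x (hst hxs) hxt
    · exact hc hs x hxs (hst hxt)
  have hTp : T ∉ p := by
    intro hm
    have h2 := (key T).1 hm
    obtain ⟨x, hx1, hx2⟩ := p.nonempty_of_mem (Filter.inter_mem hm h2)
    exact hT.prop x hx1 hx2
  have hT2 : {y | h * y ∈ T} ∉ p := fun hm => hTp ((key T).2 hm)
  have hT3 : {y | h⁻¹ * y ∈ T} ∉ p := by
    intro hm
    have := (key _).1 hm
    simp at this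
    exact hTp this
  have := Filter.inter_mem (Filter.inter_mem (Ultrafilter.compl_mem_iff_notMem.2 hTp)
    (Ultrafilter.compl_mem_iff_notMem.2 hT2)) (Ultrafilter.compl_mem_iff_notMem.2 hT3)
  obtain ⟨x, ⟨hx1, hx2⟩, hx3⟩ := p.nonempty_of_mem this
  simp only [Set.mem_compl_iff, Set.mem_ofPred_eq] at hx1 hx2 hx3
  apply hx1
  refine hT.le_of_ge (y := insert x T) ?_ (Set.subset_insert _ _) (Set.mem_insert _ _)
  rintro y (rfl | hy) (h1 | h1)
  · exact hh (mul_eq_right.1 h1)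
  · exact hx2 h1
  · apply hx3
    rw [← h1]
    simpa using hy
  · exact hT.prop y hy h1

theorem aux_part1 {G : Type*} [Group G] (A : Set G) (hA : uDisparse A) (q : Ultrafilter G)
    (hq : uFree q) (hqq : uMul q q = q) (g : G) : uMul q (pure g) ∉ uStar A := by
  intro hmem
  set p := uMul q (pure g) with hpdef
  have hpf : uFree p := hmem.2
  have hqp : ∀ s : Set G, s ∈ p ↔ ∀ᶠ x in q, s ∈ uMul (pure x) p := by
    intro s
    have h1 : s ∈ p ↔ {y | y * g ∈ s} ∈ uMul q q := by
      rw [hqq]; exact aux_mem_mul_pure g q s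
    rw [h1, aux_mem_uMul_s16]
    refine Filter.eventually_congr (Filter.Eventually.of_forall fun x => ?_)
    rw [aux_mem_pure_mul]
    change _ ↔ {y | x * y ∈ s} ∈ p
    rw [hpdef, aux_mem_mul_pure]
    simp [mul_assoc]
  have hpc : p ∈ uCompanion A p := by
    refine ⟨hmem, 1, ?_⟩
    ext s
    rw [aux_mem_pure_mul]
    simp
  have hd := hA p hpf
  have ho : IsOpen ({⟨p, hpc⟩} : Set (uCompanion A p)) := isOpen_discrete _
  obtain ⟨U, hU, hUe⟩ := isOpen_induced_iff.1 ho
  have hpU : p ∈ U := by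
    have : (⟨p, hpc⟩ : uCompanion A p) ∈ Subtype.val ⁻¹' U := by rw [hUe]; rfl
    exact this
  obtain ⟨_, ⟨B, rfl⟩, hpB, hBU⟩ := ultrafilterBasis_is_basis.exists_subset_of_mem_open hpU hU
  have hB : B ∈ p := hpB
  have e1 := (hqp _).1 (Filter.inter_mem hmem.1 hB)
  have e2 := (aux_free_iff q).1 hq 1
  obtain ⟨x, hx, hx1⟩ := (e1.and e2).exists
  have hxA : A ∈ uMul (pure x) p := Filter.mem_of_superset hx Set.inter_subset_left
  have hxB : B ∈ uMul (pure x) p := Filter.mem_of_superset hx Set.inter_subset_right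
  have hxc : uMul (pure x) p ∈ uCompanion A p := ⟨⟨hxA, aux_free_mul_s16 _ _ hpf⟩, x, rfl⟩
  have : (⟨uMul (pure x) p, hxc⟩ : uCompanion A p) ∈ Subtype.val ⁻¹' U := hBU hxB
  rw [hUe] at this
  exact aux_no_fixed x hx1 p (congrArg Subtype.val this)

theorem aux_FP {G : Type*} [Group G] (a : Stream' G) (m : G) (hm : m ∈ Hindman.FP a) :
    m ∈ uFP a.get := by
  induction hm with
  | head' a => exact ⟨[0], by simp, by simp, by simp [Stream'.head]⟩
  | tail' a m _ ih =>
    obtain ⟨l, hl, hs, rfl⟩ := ih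
    refine ⟨l.map Nat.succ, by simpa using hl, ?_, ?_⟩
    · rw [List.pairwise_map]; exact hs.imp (fun h => Nat.succ_lt_succ h)
    · rw [List.map_map]; rfl
  | cons' a m _ ih =>
    obtain ⟨l, hl, hs, rfl⟩ := ih
    refine ⟨0 :: l.map Nat.succ, by simp, ?_, ?_⟩
    · rw [List.pairwise_cons, List.pairwise_map]
      exact ⟨by simp, hs.imp (fun h => Nat.succ_lt_succ h)⟩
    · rw [List.map_cons, List.prod_cons, List.map_map]; rfl

attribute [local instance] Ultrafilter.mul Ultrafilter.semigroup

theorem aux_exists_s16 {G : Type*} [Group G] (a : Stream' G) (ha : Function.Injective a.get) :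
    ∃ q : Ultrafilter G, uFree q ∧ uMul q q = q ∧ Hindman.FP a ∈ q := by
  let S : Set (Ultrafilter G) :=
    (⋂ n, { U | Hindman.FP (a.drop n) ∈ U }) ∩ ⋂ g : G, {U | ({g}ᶜ : Set G) ∈ U}
  have hfree : ∀ U ∈ S, uFree U := fun U hU => (aux_free_iff U).2 (Set.mem_iInter.1 hU.2)
  have hex := exists_idempotent_in_compact_subsemigroup
    (Ultrafilter.continuous_mul_left (M := G)) S ?_ ?_ ?_
  · obtain ⟨U, hU, hid⟩ := hex
    exact ⟨U, hfree U hU, hid, Set.mem_iInter.1 hU.1 0⟩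
  · refine ⟨(Filter.hyperfilter ℕ).map a.get, Set.mem_iInter.2 fun n => ?_,
      Set.mem_iInter.2 fun g => ?_⟩
    · rw [Set.mem_ofPred_eq, Ultrafilter.mem_map]
      apply Filter.mem_hyperfilter_of_finite_compl
      refine (Set.finite_lt_nat n).subset fun i hi => ?_
      by_contra hin
      apply hi
      have := Hindman.FP.singleton (a.drop n) (i - n)
      rw [Stream'.get_drop] at this
      have h2 : n + (i - n) = i := by simp at hin; omega
      rw [h2] at this
      exact this
    · rw [Set.mem_ofPred_eq, Ultrafilter.mem_map]
      apply Filter.mem_hyperfilter_of_finite_compl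
      rw [← Set.preimage_compl, compl_compl]
      exact (Set.finite_singleton g).preimage ha.injOn
  · exact ((isClosed_iInter fun i => ultrafilter_isClosed_basic _).inter
      (isClosed_iInter fun i => ultrafilter_isClosed_basic _)).isCompact
  · intro U hU V hV
    refine ⟨Set.mem_iInter.2 fun n => ?_, Set.mem_iInter.2
      ((aux_free_iff (uMul U V)).1 (aux_free_mul_s16 U V (hfree V hV)))⟩
    change ∀ᶠ x in U, ∀ᶠ y in V, x * y ∈ Hindman.FP (a.drop n)
    have h1 : Hindman.FP (a.drop n) ∈ U := Set.mem_iInter.1 hU.1 n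
    filter_upwards [h1] with m hm
    obtain ⟨n', hn⟩ := Hindman.FP.mul hm
    have h2 : Hindman.FP (a.drop (n' + n)) ∈ V := Set.mem_iInter.1 hV.1 (n' + n)
    filter_upwards [h2] with m' hm'
    apply hn
    simpa only [Stream'.drop_drop, add_comm] using hm'

/-- Proposition 11: for a disparse `A`, no translate `qg` of an idempotent `q ∈ G*`
belongs to `A*`; equivalently `FP(a_n)g \ A` is infinite for every injective sequence. -/
theorem statement16 {G : Type*} [Group G] (A : Set G) (hA : uDisparse A) :
    (∀ q : Ultrafilter G, uFree q → uMul q q = q → ∀ g : G, uMul q (pure g) ∉ uStar A)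
    ∧ (∀ a : ℕ → G, Function.Injective a → ∀ g : G,
        (((· * g) '' uFP a) \ A).Infinite) := by
  refine ⟨aux_part1 A hA, fun a ha g hfin => ?_⟩
  obtain ⟨q, hq, hqq, hFP⟩ := aux_exists_s16 (G := G) a ha
  apply aux_part1 A hA q hq hqq g
  refine ⟨?_, aux_free_mul_pure q hq g⟩
  have hf := (aux_free_iff _).1 (aux_free_mul_pure q hq g)
  have h1 : ((· * g) '' uFP a) ∈ uMul q (pure g) := by
    rw [aux_mem_mul_pure]
    filter_upwards [hFP] with y hy
    exact ⟨y, aux_FP _ _ hy, rfl⟩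
  have h2 : (((· * g) '' uFP a) \ A)ᶜ ∈ uMul q (pure g) := by
    have := (Filter.biInter_mem (f := (uMul q (pure g) : Filter G)) hfin
      (s := fun x => ({x}ᶜ : Set G))).2 (fun x _ => hf x)
    refine Filter.mem_of_superset this fun x hx hx2 => ?_
    exact Set.mem_iInter₂.1 hx x hx2 rfl
  filter_upwards [h1, h2] with x hx hx2
  by_contra hxA
  exact hx2 ⟨hx, hxA⟩
end
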